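/- Let (ν_n) be a sequence of Borel probability measures on ℝ satisfying: (1) sup_n ∫ x² dν_n(x) < ∞, and (2) for every λ ∈ ℝ, the complex integral ∫ (iλ − x) e^{iλx} dν_n(x) converges to 0 as n → ∞ (i the imaginary unit). Then ν_n converges weakly to the standard normal distribution N(0,1). -/

import Mathlib

open MeasureTheory ProbabilityTheory Filter
open scoped BigOperators Topology ENNReal NNReal

/-- The derivative of the characteristic function. -/
lemma aux_deriv (μ : Measure ℝ) [IsProbabilityMeasure μ] (h : MemLp id 2 μ) (t : ℝ) :
    HasDerivAt (charFun μ) (Complex.I * ∫ x, (x : ℂ) * Complex.exp ((t : ℂ) * x * Complex.I) ∂μ) t := by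
  have h' : MemLp id ((1 : ℕ) : ℝ≥0∞) μ := by
    simpa using h.mono_exponent (p := 1) (by norm_num)
  have hd : ContDiff ℝ ((1 : ℕ) : WithTop ℕ∞) (charFun μ) := contDiff_charFun h'
  have h3 := iteratedDeriv_charFun (t := t) h'
  rw [iteratedDeriv_one] at h3
  simp only [pow_one] at h3
  rw [← h3]
  exact (hd.differentiable (by simp)).differentiableAt.hasDerivAt

lemma aux_split (μ : Measure ℝ) [IsProbabilityMeasure μ] (h : MemLp id 2 μ) (t : ℝ) :
    ∫ x, ((t : ℂ) * Complex.I - (x : ℂ)) * Complex.exp ((t : ℂ) * (x : ℂ) * Complex.I) ∂μ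
      = t * Complex.I * charFun μ t - ∫ x, (x : ℂ) * Complex.exp ((t : ℂ) * x * Complex.I) ∂μ := by
  have hi : Integrable (fun x : ℝ => x) μ := h.integrable (by norm_num)
  have hn : ∀ x : ℝ, ‖Complex.exp ((t : ℂ) * x * Complex.I)‖ = 1 := fun x => by
    have := Complex.norm_exp_ofReal_mul_I (t * x)
    simpa using this
  have i1 : Integrable (fun x : ℝ => Complex.exp ((t : ℂ) * x * Complex.I)) μ :=
    (integrable_const (1 : ℝ)).mono' (by fun_prop) (ae_of_all _ fun x => (hn x).le)
  have i2 : Integrable (fun x : ℝ => (x : ℂ) * Complex.exp ((t : ℂ) * x * Complex.I)) μ :=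
    hi.norm.mono' (by fun_prop) (ae_of_all _ fun x => by rw [norm_mul, hn]; simp)
  simp_rw [sub_mul]
  rw [integral_sub (i1.const_mul _) i2, integral_const_mul, charFun_apply_real]

lemma aux_bound (μ : Measure ℝ) [IsProbabilityMeasure μ] (h : Integrable (fun x : ℝ => x ^ 2) μ)
    (t : ℝ) :
    ‖∫ x, ((t : ℂ) * Complex.I - (x : ℂ)) * Complex.exp ((t : ℂ) * (x : ℂ) * Complex.I) ∂μ‖
      ≤ |t| + 1 + ∫ x, x ^ 2 ∂μ := by
  have hn : ∀ x : ℝ, ‖Complex.exp ((t : ℂ) * x * Complex.I)‖ = 1 := fun x => by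
    have := Complex.norm_exp_ofReal_mul_I (t * x)
    simpa using this
  have key : |t| + 1 + ∫ x, x ^ 2 ∂μ = ∫ x, (|t| + 1 + x ^ 2) ∂μ := by
    rw [integral_add (integrable_const _) h]; simp
  rw [key]
  refine norm_integral_le_of_norm_le ((integrable_const _).add h) (ae_of_all _ fun x => ?_)
  rw [norm_mul, hn, mul_one]
  refine (norm_sub_le _ _).trans ?_
  simp only [norm_mul, Complex.norm_real, Complex.norm_I, mul_one, Real.norm_eq_abs]
  nlinarith [sq_abs x, sq_nonneg (|x| - 1), abs_nonneg x]

lemma aux_ftc (μ : Measure ℝ) [IsProbabilityMeasure μ] (h : MemLp id 2 μ) (t : ℝ)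
    (g : ℝ → ℂ) (hg : ∀ s, g s = ∫ x, ((s : ℂ) * Complex.I - (x : ℂ)) *
      Complex.exp ((s : ℂ) * (x : ℂ) * Complex.I) ∂μ) :
    Continuous g ∧
    ∫ s in (0 : ℝ)..t, Complex.exp ((s : ℂ) ^ 2 / 2) * (-Complex.I * g s)
      = Complex.exp ((t : ℂ) ^ 2 / 2) * charFun μ t - 1 := by
  have h' : MemLp id ((1 : ℕ) : ℝ≥0∞) μ := by
    simpa using h.mono_exponent (p := 1) (by norm_num)
  have hd : ContDiff ℝ ((1 : ℕ) : WithTop ℕ∞) (charFun μ) := contDiff_charFun h'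
  have hgd : ∀ s, g s = Complex.I * (s * charFun μ s + deriv (charFun μ) s) := fun s => by
    rw [hg, aux_split μ h, (aux_deriv μ h s).deriv]
    linear_combination (∫ x, (x : ℂ) * Complex.exp ((s : ℂ) * x * Complex.I) ∂μ) * (-Complex.I_sq)
  have hc : Continuous g := by
    rw [funext hgd]
    have := hd.continuous_deriv (by simp)
    have := hd.continuous
    fun_prop
  refine ⟨hc, ?_⟩
  rw [intervalIntegral.integral_eq_sub_of_hasDerivAt
    (f := fun s : ℝ => Complex.exp ((s : ℂ) ^ 2 / 2) * charFun μ s)]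
  · simp
  · intro s _
    have e1 : HasDerivAt (fun s : ℝ => Complex.exp ((s : ℂ) ^ 2 / 2))
        (Complex.exp ((s : ℂ) ^ 2 / 2) * s) s := by
      have := (((hasDerivAt_id (s : ℂ)).pow 2).div_const 2).cexp.comp_ofReal
      refine this.congr_deriv ?_
      simp only [Pi.pow_apply, id]
      push_cast
      ring
    have e2 := e1.mul ((hd.differentiable (by simp)) s).hasDerivAt
    refine e2.congr_deriv ?_
    rw [hgd]
    linear_combination -Complex.exp ((s : ℂ) ^ 2 / 2) * 
      (s * charFun μ s + deriv (charFun μ) s) * (-Complex.I_sq)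
  · apply Continuous.intervalIntegrable
    fun_prop

/-- Bolthausen's sufficient condition for asymptotic normality: if a sequence of Borel
probability measures `ν n` on `ℝ` has uniformly bounded second moments and, for every
`λ ∈ ℝ`, `∫ (iλ - x) e^{iλx} dν_n(x) → 0`, then `ν n` converges weakly to `N(0,1)`. -/
theorem bolthausen_clt_criterion (ν : ℕ → Measure ℝ)
    (hprob : ∀ n, IsProbabilityMeasure (ν n))
    (h1 : (⨆ n, ∫⁻ x, ENNReal.ofReal (x ^ 2) ∂(ν n)) < ⊤)
    (h2 : ∀ l : ℝ,
      Tendsto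
        (fun n => ∫ x, ((l : ℂ) * Complex.I - (x : ℂ)) *
          Complex.exp ((l : ℂ) * (x : ℂ) * Complex.I) ∂(ν n))
        atTop (𝓝 0)) :
    ∀ f : BoundedContinuousFunction ℝ ℝ,
      Tendsto (fun n => ∫ x, f x ∂(ν n)) atTop (𝓝 (∫ x, f x ∂(gaussianReal 0 1))) := by
  have hfin : ∀ n, ∫⁻ x, ENNReal.ofReal (x ^ 2) ∂(ν n) ≤
      ⨆ n, ∫⁻ x, ENNReal.ofReal (x ^ 2) ∂(ν n) := fun n =>
    le_iSup (fun n => ∫⁻ x, ENNReal.ofReal (x ^ 2) ∂(ν n)) n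
  have hint : ∀ n, Integrable (fun x : ℝ => x ^ 2) (ν n) := fun n => by
    refine ⟨by fun_prop, ?_⟩
    rw [hasFiniteIntegral_iff_ofReal (ae_of_all _ fun x => sq_nonneg x)]
    exact (hfin n).trans_lt h1
  have hmem : ∀ n, MemLp id 2 (ν n) := fun n =>
    (memLp_two_iff_integrable_sq (by fun_prop)).2 (hint n)
  obtain ⟨C, hC⟩ : ∃ C : ℝ, ∀ n, ∫ x, x ^ 2 ∂(ν n) ≤ C := by
    refine ⟨(⨆ n, ∫⁻ x, ENNReal.ofReal (x ^ 2) ∂(ν n)).toReal, fun n => ?_⟩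
    rw [integral_eq_lintegral_of_nonneg_ae (ae_of_all _ fun x => sq_nonneg x) (by fun_prop)]
    exact ENNReal.toReal_mono h1.ne (hfin n)
  have hchar : ∀ t : ℝ, Tendsto (fun n => charFun (ν n) t) atTop
      (𝓝 (charFun (gaussianReal 0 1) t)) := by
    intro t
    have hI := fun n => aux_ftc (ν n) (hmem n) t _ (fun s => rfl)
    have lim : Tendsto (fun n => ∫ s in (0 : ℝ)..t, Complex.exp ((s : ℂ) ^ 2 / 2) *
        (-Complex.I * ∫ x, ((s : ℂ) * Complex.I - (x : ℂ)) *
          Complex.exp ((s : ℂ) * (x : ℂ) * Complex.I) ∂(ν n))) atTop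
        (𝓝 (∫ s in (0 : ℝ)..t, (0 : ℂ))) := by
      refine intervalIntegral.tendsto_integral_filter_of_dominated_convergence
        (fun s : ℝ => ‖Complex.exp ((s : ℂ) ^ 2 / 2)‖ * (|s| + 1 + C)) ?_ ?_ ?_ ?_
      · refine Eventually.of_forall fun n => Continuous.aestronglyMeasurable ?_
        have := (hI n).1
        fun_prop
      · refine Eventually.of_forall fun n => ae_of_all _ fun s _ => ?_
        rw [norm_mul, norm_mul, norm_neg, Complex.norm_I, one_mul]
        gcongr
        exact (aux_bound (ν n) (hint n) s).trans (by gcongr; exact hC n)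
      · apply Continuous.intervalIntegrable
        fun_prop
      · refine ae_of_all _ fun s _ => ?_
        simpa using ((h2 s).const_mul (-Complex.I)).const_mul (Complex.exp ((s : ℂ) ^ 2 / 2))
    have lim2 := ((lim.congr fun n => (hI n).2).add_const 1).const_mul
      (Complex.exp (-((t : ℂ) ^ 2 / 2)))
    rw [charFun_gaussianReal]
    convert lim2 using 2
    · rw [sub_add_cancel, ← mul_assoc, ← Complex.exp_add]; simp
    · simp
  have := ProbabilityMeasure.tendsto_of_tendsto_charFun
    (μ := fun n => (⟨ν n, hprob n⟩ : ProbabilityMeasure ℝ))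
    (μ₀ := ⟨gaussianReal 0 1, inferInstance⟩) hchar
  exact ProbabilityMeasure.tendsto_iff_forall_integral_tendsto.1 this
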